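/- arXiv:1302.1621 — 5 statements merged into one kernel-verified Lean document; each statement's English description precedes it below -/
import Mathlib

section
/- Let L > 0 and let p denote the Dirichlet heat kernel on [0,L]. Then for every β > 0, t > 0 and x ∈ [0,L], one has ∫₀ᵗ e^{−β(t−s)} ∫₀ᴸ [p_{t−s}(x,y)]² dy ds ≤ 1/(2√β). -/
open MeasureTheory Real

/-- The Dirichlet heat kernel on `[0, L]`:
`p_t(x,y) = ∑_{n=1}^∞ φ_n(x) φ_n(y) e^{-μ_n t}` where `μ_n = (nπ/L)²`
and `φ_n(x) = √(2/L) sin(nπx/L)`. -/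
noncomputable def dirichletHeatKernel (L t x y : ℝ) : ℝ :=
  ∑' n : ℕ,
    (Real.sqrt (2 / L) * Real.sin (((n : ℝ) + 1) * π * x / L)) *
      (Real.sqrt (2 / L) * Real.sin (((n : ℝ) + 1) * π * y / L)) *
        Real.exp (-((((n : ℝ) + 1) * π / L) ^ 2) * t)

open intervalIntegral

/-- The `L²`-normalised Dirichlet eigenfunctions on `[0, L]`, indexed from `0`. -/
noncomputable def dirichletMode (L : ℝ) (n : ℕ) (y : ℝ) : ℝ :=
  Real.sqrt (2 / L) * Real.sin (((n : ℝ) + 1) * π * y / L)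

/-- The square root of the `n`-th Dirichlet eigenvalue on `[0, L]`, indexed from `0`. -/
noncomputable def dirichletFrequency (L : ℝ) (n : ℕ) : ℝ := ((n : ℝ) + 1) * π / L

/-- The `L²`-normalised Neumann eigenfunctions on `[0, L]` of nonzero frequency. -/
noncomputable def neumannMode (L : ℝ) (n : ℕ) (y : ℝ) : ℝ :=
  Real.sqrt (2 / L) * Real.cos (((n : ℝ) + 1) * π * y / L)

theorem continuous_dirichletMode (L : ℝ) (n : ℕ) : Continuous (dirichletMode L n) := by
  unfold dirichletMode; fun_prop

theorem continuous_neumannMode (L : ℝ) (n : ℕ) : Continuous (neumannMode L n) := by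
  unfold neumannMode; fun_prop

theorem hasDerivAt_dirichletMode (L : ℝ) (n : ℕ) (y : ℝ) :
    HasDerivAt (dirichletMode L n) (dirichletFrequency L n * neumannMode L n y) y := by
  have h : HasDerivAt (fun y : ℝ => ((n : ℝ) + 1) * π * y / L) (((n : ℝ) + 1) * π / L) y := by
    simpa using ((hasDerivAt_id y).const_mul (((n : ℝ) + 1) * π)).div_const L
  refine (h.sin.const_mul (Real.sqrt (2 / L))).congr_deriv ?_
  unfold dirichletFrequency neumannMode
  ring

theorem abs_dirichletMode_le (L : ℝ) (n : ℕ) (y : ℝ) :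
    |dirichletMode L n y| ≤ Real.sqrt (2 / L) := by
  unfold dirichletMode
  rw [abs_mul, abs_of_nonneg (Real.sqrt_nonneg _)]
  exact mul_le_of_le_one_right (Real.sqrt_nonneg _) (Real.abs_sin_le_one _)

theorem dirichletMode_zero (L : ℝ) (n : ℕ) : dirichletMode L n 0 = 0 := by
  simp [dirichletMode]

theorem dirichletMode_right {L : ℝ} (hL : 0 < L) (n : ℕ) : dirichletMode L n L = 0 := by
  have h : ((n : ℝ) + 1) * π * L / L = ((n + 1 : ℕ) : ℝ) * π := by
    push_cast; field_simp
  rw [dirichletMode, h, Real.sin_nat_mul_pi, mul_zero]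

theorem integral_cos_int_mul_pi_div {L : ℝ} (hL : 0 < L) (k : ℤ) :
    ∫ y in (0 : ℝ)..L, Real.cos (k * π * y / L) = if k = 0 then L else 0 := by
  split_ifs with hk
  · simp [hk]
  · have hc : (k : ℝ) * π / L ≠ 0 := by
      have : (k : ℝ) ≠ 0 := by exact_mod_cast hk
      exact div_ne_zero (mul_ne_zero this Real.pi_ne_zero) hL.ne'
    have h : ∀ y : ℝ, (k : ℝ) * π * y / L = (k : ℝ) * π / L * y := fun y => by ring
    simp_rw [h]
    rw [intervalIntegral.integral_comp_mul_left _ hc, integral_cos, div_mul_cancel₀ _ hL.ne',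
      Real.sin_int_mul_pi]
    simp

theorem integral_dirichletMode_mul {L : ℝ} (hL : 0 < L) (n m : ℕ) :
    ∫ y in (0 : ℝ)..L, dirichletMode L n y * dirichletMode L m y = if n = m then 1 else 0 := by
  have h : ∀ y, dirichletMode L n y * dirichletMode L m y =
      1 / L * (Real.cos (((n - m : ℤ) : ℝ) * π * y / L)
        - Real.cos (((n + m + 2 : ℤ) : ℝ) * π * y / L)) := fun y => by
    have hs : Real.sqrt (2 / L) * Real.sqrt (2 / L) = 2 / L := Real.mul_self_sqrt (by positivity)
    have h₁ : ((n - m : ℤ) : ℝ) * π * y / L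
        = ((n : ℝ) + 1) * π * y / L - ((m : ℝ) + 1) * π * y / L := by push_cast; ring
    have h₂ : ((n + m + 2 : ℤ) : ℝ) * π * y / L
        = ((n : ℝ) + 1) * π * y / L + ((m : ℝ) + 1) * π * y / L := by push_cast; ring
    rw [h₁, h₂, Real.cos_sub, Real.cos_add, dirichletMode, dirichletMode, mul_mul_mul_comm, hs]
    ring
  simp_rw [h]
  rw [intervalIntegral.integral_const_mul, intervalIntegral.integral_sub
    (Continuous.intervalIntegrable (by fun_prop) _ _)
    (Continuous.intervalIntegrable (by fun_prop) _ _),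
    integral_cos_int_mul_pi_div hL, integral_cos_int_mul_pi_div hL,
    if_neg (show ¬ ((n + m + 2 : ℤ) = 0) by lia)]
  by_cases hnm : n = m
  · simp [hnm, hL.ne']
  · rw [if_neg (by lia), if_neg hnm]; simp

theorem integral_neumannMode_mul {L : ℝ} (hL : 0 < L) (n m : ℕ) :
    ∫ y in (0 : ℝ)..L, neumannMode L n y * neumannMode L m y = if n = m then 1 else 0 := by
  have h : ∀ y, neumannMode L n y * neumannMode L m y =
      1 / L * (Real.cos (((n - m : ℤ) : ℝ) * π * y / L)
        + Real.cos (((n + m + 2 : ℤ) : ℝ) * π * y / L)) := fun y => by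
    have hs : Real.sqrt (2 / L) * Real.sqrt (2 / L) = 2 / L := Real.mul_self_sqrt (by positivity)
    have h₁ : ((n - m : ℤ) : ℝ) * π * y / L
        = ((n : ℝ) + 1) * π * y / L - ((m : ℝ) + 1) * π * y / L := by push_cast; ring
    have h₂ : ((n + m + 2 : ℤ) : ℝ) * π * y / L
        = ((n : ℝ) + 1) * π * y / L + ((m : ℝ) + 1) * π * y / L := by push_cast; ring
    rw [h₁, h₂, Real.cos_sub, Real.cos_add, neumannMode, neumannMode, mul_mul_mul_comm, hs]
    ring
  simp_rw [h]
  rw [intervalIntegral.integral_const_mul, intervalIntegral.integral_add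
    (Continuous.intervalIntegrable (by fun_prop) _ _)
    (Continuous.intervalIntegrable (by fun_prop) _ _),
    integral_cos_int_mul_pi_div hL, integral_cos_int_mul_pi_div hL,
    if_neg (show ¬ ((n + m + 2 : ℤ) = 0) by lia)]
  by_cases hnm : n = m
  · simp [hnm, hL.ne']
  · rw [if_neg (by lia), if_neg hnm]; simp

/-- Parseval's identity for finite combinations of continuous orthonormal functions. -/
theorem integral_sq_sum_of_orthonormal {a b : ℝ} {e : ℕ → ℝ → ℝ} (he : ∀ n, Continuous (e n))
    (horth : ∀ n m, ∫ y in a..b, e n y * e m y = if n = m then 1 else 0)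
    (F : Finset ℕ) (c : ℕ → ℝ) :
    ∫ y in a..b, (∑ n ∈ F, c n * e n y) ^ 2 = ∑ n ∈ F, c n ^ 2 := by
  have h : ∀ y, (∑ n ∈ F, c n * e n y) ^ 2
      = ∑ n ∈ F, ∑ m ∈ F, c n * c m * (e n y * e m y) := fun y => by
    rw [sq, Finset.sum_mul_sum]
    exact Finset.sum_congr rfl fun n _ => Finset.sum_congr rfl fun m _ => by ring
  simp_rw [h]
  rw [intervalIntegral.integral_finsetSum
    fun n _ => Continuous.intervalIntegrable (by fun_prop) _ _]
  refine Finset.sum_congr rfl fun n hn => ?_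
  rw [intervalIntegral.integral_finsetSum
    fun n _ => Continuous.intervalIntegrable (by fun_prop) _ _]
  simp_rw [intervalIntegral.integral_const_mul, horth]
  simp [hn, sq]

/-- The sharp pointwise bound on a function vanishing at both ends of `[0, L]` by its energy. -/
theorem two_mul_sq_le_energy {L κ x : ℝ} (hx : x ∈ Set.Icc (0 : ℝ) L) {f f' : ℝ → ℝ}
    (hf : ∀ y, HasDerivAt f (f' y) y) (hf' : Continuous f') (h0 : f 0 = 0) (h1 : f L = 0) :
    2 * κ * f x ^ 2 ≤ (∫ y in (0 : ℝ)..L, f' y ^ 2) + κ ^ 2 * ∫ y in (0 : ℝ)..L, f y ^ 2 := by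
  have hfc : Continuous f := continuous_iff_continuousAt.2 fun y => (hf y).continuousAt
  have hd : ∀ y, HasDerivAt (fun z => κ * f z ^ 2) (2 * κ * f y * f' y) y := fun y => by
    refine (((hf y).pow 2).const_mul κ).congr_deriv ?_
    simp
    ring
  have hi : ∀ {g : ℝ → ℝ}, Continuous g → ∀ a b, IntervalIntegrable g volume a b :=
    fun hg a b => hg.intervalIntegrable a b
  have hleft : κ * f x ^ 2 ≤ ∫ y in (0 : ℝ)..x, (f' y ^ 2 + κ ^ 2 * f y ^ 2) := by
    have h := integral_eq_sub_of_hasDerivAt (a := 0) (b := x) (fun y _ => hd y)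
      (hi (by fun_prop) _ _)
    rw [h0] at h
    have h' : κ * f x ^ 2 = ∫ y in (0 : ℝ)..x, 2 * κ * f y * f' y := by rw [h]; ring
    rw [h']
    exact integral_mono_on hx.1 (hi (by fun_prop) _ _) (hi (by fun_prop) _ _)
      fun y _ => by nlinarith [sq_nonneg (f' y - κ * f y)]
  have hright : κ * f x ^ 2 ≤ ∫ y in x..L, (f' y ^ 2 + κ ^ 2 * f y ^ 2) := by
    have h := integral_eq_sub_of_hasDerivAt (a := x) (b := L) (fun y _ => hd y)
      (hi (by fun_prop) _ _)
    rw [h1] at h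
    have h' : κ * f x ^ 2 = ∫ y in x..L, -(2 * κ * f y * f' y) := by
      rw [intervalIntegral.integral_neg, h]; ring
    rw [h']
    exact integral_mono_on hx.2 (hi (by fun_prop) _ _) (hi (by fun_prop) _ _)
      fun y _ => by nlinarith [sq_nonneg (f' y + κ * f y)]
  rw [← intervalIntegral.integral_const_mul, ← intervalIntegral.integral_add
    (hi (by fun_prop) _ _) (hi (by fun_prop) _ _),
    ← integral_add_adjacent_intervals (b := x) (hi (by fun_prop) _ _) (hi (by fun_prop) _ _)]
  linarith

/-- The partial sums of the Dirichlet Green function on the diagonal are at most the value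
`1 / (2κ)` of the Green function of the whole line. -/
theorem sum_dirichletMode_sq_div_le {L κ x : ℝ} (hL : 0 < L) (hκ : 0 < κ)
    (hx : x ∈ Set.Icc (0 : ℝ) L) (F : Finset ℕ) :
    ∑ n ∈ F, dirichletMode L n x ^ 2 / (dirichletFrequency L n ^ 2 + κ ^ 2) ≤ 1 / (2 * κ) := by
  set S := ∑ n ∈ F, dirichletMode L n x ^ 2 / (dirichletFrequency L n ^ 2 + κ ^ 2)
  have hpos : ∀ n, 0 < dirichletFrequency L n ^ 2 + κ ^ 2 := fun n => by positivity
  set c : ℕ → ℝ := fun n => dirichletMode L n x / (dirichletFrequency L n ^ 2 + κ ^ 2) with hc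
  have hfx : ∑ n ∈ F, c n * dirichletMode L n x = S :=
    Finset.sum_congr rfl fun n _ => by simp only [hc]; ring
  have hd : ∀ y, HasDerivAt (fun y => ∑ n ∈ F, c n * dirichletMode L n y)
      (∑ n ∈ F, c n * dirichletFrequency L n * neumannMode L n y) y := fun y => by
    refine (HasDerivAt.fun_sum fun n _ =>
      (hasDerivAt_dirichletMode L n y).const_mul (c n)).congr_deriv ?_
    exact Finset.sum_congr rfl fun n _ => by ring
  have hcont : Continuous fun y => ∑ n ∈ F, c n * dirichletFrequency L n * neumannMode L n y :=
    continuous_finsetSum _ fun n _ => continuous_const.mul (continuous_neumannMode L n)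
  have h := two_mul_sq_le_energy (κ := κ) hx hd hcont (by simp [dirichletMode_zero])
    (by simp [dirichletMode_right hL])
  rw [integral_sq_sum_of_orthonormal (continuous_dirichletMode L) (integral_dirichletMode_mul hL),
    integral_sq_sum_of_orthonormal (continuous_neumannMode L) (integral_neumannMode_mul hL)
      F (fun n => c n * dirichletFrequency L n), hfx, Finset.mul_sum,
    ← Finset.sum_add_distrib] at h
  have henergy : ∑ n ∈ F, ((c n * dirichletFrequency L n) ^ 2 + κ ^ 2 * c n ^ 2) = S :=
    Finset.sum_congr rfl fun n _ => by
      have := (hpos n).ne'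
      simp only [hc]
      field_simp
  rw [henergy] at h
  rw [le_div_iff₀ (by positivity)]
  have hS0 : 0 ≤ S := Finset.sum_nonneg fun n _ => div_nonneg (sq_nonneg _) (hpos n).le
  rcases hS0.eq_or_lt with h0 | h0
  · rw [← h0]; simp
  · nlinarith

/-- Parseval's identity for an absolutely summable sine series. -/
theorem hasSum_integral_sq_tsum_dirichletMode {L : ℝ} (hL : 0 < L) {c : ℕ → ℝ}
    (hc : Summable fun n => |c n|) :
    HasSum (fun n => c n ^ 2) (∫ y in (0 : ℝ)..L, (∑' n, c n * dirichletMode L n y) ^ 2) := by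
  have hle : ∀ y n, |c n * dirichletMode L n y| ≤ |c n| * Real.sqrt (2 / L) := fun y n => by
    rw [abs_mul]
    exact mul_le_mul_of_nonneg_left (abs_dirichletMode_le L n y) (abs_nonneg _)
  have hsum := hc.mul_right (Real.sqrt (2 / L))
  have hlim : Filter.Tendsto
      (fun F : Finset ℕ => ∫ y in (0 : ℝ)..L, (∑ n ∈ F, c n * dirichletMode L n y) ^ 2)
      Filter.atTop (nhds (∫ y in (0 : ℝ)..L, (∑' n, c n * dirichletMode L n y) ^ 2)) := by
    refine intervalIntegral.tendsto_integral_filter_of_dominated_convergence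
      (fun _ => (∑' n, |c n| * Real.sqrt (2 / L)) ^ 2) ?_ ?_ ?_ ?_
    · refine Filter.Eventually.of_forall fun F => Continuous.aestronglyMeasurable ?_
      exact (continuous_finsetSum _ fun n _ =>
        continuous_const.mul (continuous_dirichletMode L n)).pow 2
    · refine Filter.Eventually.of_forall fun F => Filter.Eventually.of_forall fun y _ => ?_
      rw [norm_pow, Real.norm_eq_abs]
      refine pow_le_pow_left₀ (abs_nonneg _) ?_ 2
      calc |∑ n ∈ F, c n * dirichletMode L n y|
          ≤ ∑ n ∈ F, |c n * dirichletMode L n y| := Finset.abs_sum_le_sum_abs _ _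
        _ ≤ ∑ n ∈ F, |c n| * Real.sqrt (2 / L) := Finset.sum_le_sum fun n _ => hle y n
        _ ≤ ∑' n, |c n| * Real.sqrt (2 / L) :=
          hsum.sum_le_tsum _ fun n _ => by positivity
    · exact intervalIntegrable_const
    · refine Filter.Eventually.of_forall fun y _ => Filter.Tendsto.pow ?_ 2
      exact (Summable.of_norm_bounded hsum (hle y)).hasSum
  simpa only [HasSum, SummationFilter.unconditional_filter, integral_sq_sum_of_orthonormal
    (continuous_dirichletMode L) (integral_dirichletMode_mul hL)] using hlim

theorem summable_abs_dirichletMode_mul_exp {L u : ℝ} (hL : 0 < L) (hu : 0 < u) (x : ℝ) :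
    Summable fun n =>
      |dirichletMode L n x * Real.exp (-(dirichletFrequency L n ^ 2) * u)| := by
  have hr : -((π / L) ^ 2 * u) < 0 := neg_lt_zero.2 (by positivity)
  have hsum := (Real.summable_exp_nat_mul_of_ge hr (f := fun n : ℕ => ((n : ℝ) + 1) ^ 2)
    fun n => by nlinarith [(Nat.cast_nonneg n : (0 : ℝ) ≤ n)]).mul_left (Real.sqrt (2 / L))
  refine Summable.of_nonneg_of_le (fun n => abs_nonneg _) (fun n => ?_) hsum
  have he : -(dirichletFrequency L n ^ 2) * u = -((π / L) ^ 2 * u) * ((n : ℝ) + 1) ^ 2 := by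
    unfold dirichletFrequency; ring
  rw [abs_mul, Real.abs_exp, he]
  exact mul_le_mul_of_nonneg_right (abs_dirichletMode_le L n x) (Real.exp_pos _).le

/-- The reproducing property of the Dirichlet heat kernel, in spectral form. -/
theorem hasSum_integral_dirichletHeatKernel_sq {L u : ℝ} (hL : 0 < L) (hu : 0 < u) (x : ℝ) :
    HasSum (fun n => dirichletMode L n x ^ 2 * Real.exp (-(2 * dirichletFrequency L n ^ 2) * u))
      (∫ y in (0 : ℝ)..L, dirichletHeatKernel L u x y ^ 2) := by
  have h := hasSum_integral_sq_tsum_dirichletMode hL (summable_abs_dirichletMode_mul_exp hL hu x)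
  have hk : ∀ y, dirichletHeatKernel L u x y = ∑' n, dirichletMode L n x *
      Real.exp (-(dirichletFrequency L n ^ 2) * u) * dirichletMode L n y := fun y =>
    tsum_congr fun n => by unfold dirichletMode dirichletFrequency; ring
  simp_rw [hk]
  refine h.congr_fun fun n => ?_
  rw [mul_pow, ← Real.exp_nat_mul]
  congr 2
  push_cast
  ring

theorem integral_exp_neg_mul_sub_le {a : ℝ} (ha : 0 < a) (t : ℝ) :
    ∫ s in (0 : ℝ)..t, Real.exp (-a * (t - s)) ≤ 1 / a := by
  rw [intervalIntegral.integral_comp_sub_left (fun u => Real.exp (-a * u)),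
    intervalIntegral.integral_comp_mul_left (fun u => Real.exp u) (neg_ne_zero.2 ha.ne'),
    integral_exp]
  simp only [sub_self, mul_zero, Real.exp_zero, sub_zero, smul_eq_mul]
  rw [inv_neg, neg_mul, ← mul_neg, neg_sub, one_div]
  exact mul_le_of_le_one_right (by positivity) (by linarith [Real.exp_pos (-a * t)])

theorem dirichlet_resolvent_pointwise_bound
    (L : ℝ) (hL : 0 < L) (β t : ℝ) (hβ : 0 < β) (ht : 0 < t)
    (x : ℝ) (hx : x ∈ Set.Icc (0 : ℝ) L) :
    (∫ s in (0 : ℝ)..t, Real.exp (-β * (t - s)) *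
        ∫ y in (0 : ℝ)..L, (dirichletHeatKernel L (t - s) x y) ^ 2)
      ≤ 1 / (2 * Real.sqrt β) := by
  set κ := Real.sqrt (β / 2)
  have hκ0 : 0 < κ := Real.sqrt_pos.2 (by positivity)
  have hκ2 : κ ^ 2 = β / 2 := Real.sq_sqrt (by positivity)
  set g : ℕ → ℝ → ℝ := fun n s => dirichletMode L n x ^ 2 *
    Real.exp (-(β + 2 * dirichletFrequency L n ^ 2) * (t - s)) with hg
  have hg0 : ∀ n s, 0 ≤ g n s := fun n s => by positivity
  have hgc : ∀ n, Continuous (g n) := fun n => by simp only [hg]; fun_prop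
  have hgint : ∀ n, ∫ s in (0 : ℝ)..t, g n s ≤
      1 / 2 * (dirichletMode L n x ^ 2 / (dirichletFrequency L n ^ 2 + κ ^ 2)) := fun n => by
    have ha : 0 < β + 2 * dirichletFrequency L n ^ 2 := by positivity
    simp only [hg]
    rw [intervalIntegral.integral_const_mul]
    calc _ ≤ dirichletMode L n x ^ 2 * (1 / (β + 2 * dirichletFrequency L n ^ 2)) :=
          mul_le_mul_of_nonneg_left (integral_exp_neg_mul_sub_le ha t) (sq_nonneg _)
      _ = _ := by rw [hκ2]; field_simp; ring
  have hpartial : ∀ F : Finset ℕ, ∑ n ∈ F, ∫ s in (0 : ℝ)..t, g n s ≤ 1 / (2 * Real.sqrt β) :=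
    fun F => by
      have hle : Real.sqrt β ≤ 2 * κ := Real.sqrt_le_iff.2 ⟨by positivity, by nlinarith⟩
      calc _ ≤ ∑ n ∈ F,
            1 / 2 * (dirichletMode L n x ^ 2 / (dirichletFrequency L n ^ 2 + κ ^ 2)) :=
            Finset.sum_le_sum fun n _ => hgint n
        _ ≤ 1 / 2 * (1 / (2 * κ)) := by
          rw [← Finset.mul_sum]
          exact mul_le_mul_of_nonneg_left (sum_dirichletMode_sq_div_le hL hκ0 hx F) (by norm_num)
        _ ≤ 1 / 2 * (1 / Real.sqrt β) := by gcongr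
        _ = _ := by ring
  have hnonneg : ∀ n, 0 ≤ ∫ s in (0 : ℝ)..t, g n s := fun n =>
    intervalIntegral.integral_nonneg ht.le fun s _ => hg0 n s
  have hsummable : Summable fun n => ∫ s in (0 : ℝ)..t, g n s :=
    summable_of_sum_le hnonneg hpartial
  have heq : ∫ s in (0 : ℝ)..t, Real.exp (-β * (t - s)) *
        ∫ y in (0 : ℝ)..L, (dirichletHeatKernel L (t - s) x y) ^ 2
      = ∫ s in (0 : ℝ)..t, ∑' n, g n s := by
    refine intervalIntegral.integral_congr_ae ?_
    filter_upwards [compl_mem_ae_iff.2 (measure_singleton (μ := volume) t)] with s hs hmem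
    rw [Set.uIoc_of_le ht.le] at hmem
    have hu : 0 < t - s := sub_pos.2 (lt_of_le_of_ne hmem.2 hs)
    rw [← (hasSum_integral_dirichletHeatKernel_sq hL hu x).tsum_eq, ← tsum_mul_left]
    refine tsum_congr fun n => ?_
    simp only [hg]
    rw [mul_left_comm, ← Real.exp_add]
    congr 2
    ring
  rw [heq]
  simp_rw [intervalIntegral.integral_of_le ht.le] at hsummable hpartial ⊢
  rw [← integral_tsum_of_summable_integral_norm
    (fun n => (intervalIntegrable_iff_integrableOn_Ioc_of_le ht.le).1
      ((hgc n).intervalIntegrable 0 t))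
    (by simpa only [Real.norm_of_nonneg (hg0 _ _)] using hsummable)]
  exact hsummable.tsum_le_of_sum_le hpartial
end

section
/- Let L > 0, let p denote the Neumann heat kernel on [0,L], and define Φ(τ) := ∫₀^τ ∫₀ᴸ ∫₀ᴸ [p_s(x,y)]² dx dy ds for τ > 0. Then Φ(τ) ≥ L · √(τ/(2π)) for every τ > 0. -/
open MeasureTheory Real

/-- The Gaussian heat kernel on `ℝ`: `Γ_t(z) = (4πt)^{-1/2} exp(-z²/(4t))`. -/
noncomputable def heatGauss (t z : ℝ) : ℝ :=
  Real.exp (-z ^ 2 / (4 * t)) / Real.sqrt (4 * π * t)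

/-- The Neumann heat kernel on `[0, L]`, obtained by the method of images:
`p_t(x,y) = ∑_{n ∈ ℤ} [Γ_t(x-y-2nL) + Γ_t(x+y-2nL)]`. -/
noncomputable def neumannHeatKernel (L t x y : ℝ) : ℝ :=
  ∑' n : ℤ, (heatGauss t (x - y - 2 * (n : ℝ) * L) + heatGauss t (x + y - 2 * (n : ℝ) * L))

lemma heatGauss_nonneg (t z : ℝ) : 0 ≤ heatGauss t z := by
  unfold heatGauss; positivity

lemma measurable_heatGauss : Measurable fun q : ℝ × ℝ => heatGauss q.1 q.2 := by
  unfold heatGauss; fun_prop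

lemma integral_heatGauss {s : ℝ} (hs : 0 < s) : ∫ z, heatGauss s z = 1 := by
  have h : ∀ z, heatGauss s z = exp (-(1 / (4 * s)) * z ^ 2) / √(4 * π * s) := fun z => by
    unfold heatGauss; congr 2; ring
  simp_rw [h]
  rw [integral_div, integral_gaussian, show π / (1 / (4 * s)) = 4 * π * s by field_simp]
  exact div_self (by positivity)

lemma integrable_heatGauss {s : ℝ} (hs : 0 < s) : Integrable (heatGauss s) :=
  .of_integral_ne_zero (by rw [integral_heatGauss hs]; exact one_ne_zero)

lemma heatGauss_sq {s : ℝ} (hs : 0 < s) (z : ℝ) :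
    heatGauss s z ^ 2 = exp (-(1 / (2 * s)) * z ^ 2) / (4 * π * s) := by
  unfold heatGauss
  rw [div_pow, sq_sqrt (by positivity), ← exp_nat_mul]
  congr 2
  push_cast
  field_simp
  ring

lemma integral_heatGauss_sq {s : ℝ} (hs : 0 < s) :
    ∫ z, heatGauss s z ^ 2 = 1 / √(8 * π * s) := by
  simp_rw [heatGauss_sq hs]
  rw [integral_div, integral_gaussian, show π / (1 / (2 * s)) = 2 * π * s by field_simp,
    show 8 * π * s = 2 ^ 2 * (2 * π * s) by ring, sqrt_mul (sq_nonneg 2) (2 * π * s),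
    sqrt_sq (by norm_num)]
  have h : √(2 * π * s) * √(2 * π * s) = 2 * π * s := mul_self_sqrt (by positivity)
  have h0 : 0 < √(2 * π * s) := by positivity
  field_simp
  nlinarith

lemma integrable_heatGauss_sq {s : ℝ} (hs : 0 < s) : Integrable fun z => heatGauss s z ^ 2 :=
  .of_integral_ne_zero (by rw [integral_heatGauss_sq hs]; positivity)

lemma lintegral_heatGauss {s : ℝ} (hs : 0 < s) :
    ∫⁻ z, ENNReal.ofReal (heatGauss s z) = 1 := by
  rw [← ofReal_integral_eq_lintegral_ofReal (integrable_heatGauss hs)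
    (.of_forall fun z => heatGauss_nonneg s z), integral_heatGauss hs, ENNReal.ofReal_one]

lemma lintegral_heatGauss_sq {s : ℝ} (hs : 0 < s) :
    ∫⁻ z, ENNReal.ofReal (heatGauss s z) ^ 2 = ENNReal.ofReal (1 / √(8 * π * s)) := by
  simp_rw [← ENNReal.ofReal_pow (heatGauss_nonneg s _)]
  rw [← ofReal_integral_eq_lintegral_ofReal (integrable_heatGauss_sq hs)
    (.of_forall fun z => sq_nonneg _), integral_heatGauss_sq hs]

/-- Unfolding the line along the reflections at the endpoints of `[0, L]`. -/
lemma lintegral_tsum_images {L : ℝ} (hL : 0 < L) {f : ℝ → ENNReal} (hf : Measurable f) (x : ℝ) :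
    ∫⁻ y in Set.Ioc 0 L, ∑' n : ℤ, (f (x - y - 2 * (n : ℝ) * L) + f (x + y - 2 * (n : ℝ) * L))
      = ∫⁻ z, f z := by
  have period (n : ℤ) :
      ∫⁻ y in Set.Ioc 0 L, (f (x - y - 2 * (n : ℝ) * L) + f (x + y - 2 * (n : ℝ) * L))
        = ∫⁻ z in Set.Ioc (-L + n • (2 * L)) (-L + (n + 1) • (2 * L)), f (x - z) := by
    have reflect : ∫⁻ y in Set.Ioc 0 L, f (x + y - 2 * (n : ℝ) * L)
        = ∫⁻ y in Set.Ioc (-L) 0, f (x - y - 2 * (n : ℝ) * L) := by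
      rw [setLIntegral_congr (Ico_ae_eq_Ioc (μ := volume) (a := -L) (b := 0)).symm,
        ← (Measure.measurePreserving_neg (volume : Measure ℝ)).setLIntegral_comp_preimage
          measurableSet_Ico (by fun_prop)]
      simp
    have translate := (measurePreserving_add_right (volume : Measure ℝ)
      (2 * (n : ℝ) * L)).setLIntegral_comp_preimage
        (s := Set.Ioc (-L + n • (2 * L)) (-L + (n + 1) • (2 * L))) (f := fun z => f (x - z))
        measurableSet_Ioc (by fun_prop)
    rw [lintegral_add_left (by fun_prop), reflect, add_comm,
      ← lintegral_union measurableSet_Ioc (by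
        rw [Set.Ioc_disjoint_Ioc]; simp [hL.le]),
      Set.Ioc_union_Ioc_eq_Ioc (by linarith) hL.le, ← translate, Set.preimage_add_const_Ioc]
    simp only [zsmul_eq_mul, Int.cast_add, Int.cast_one, sub_sub]
    congr 3 <;> ring
  rw [lintegral_tsum (fun n => by fun_prop)]
  simp_rw [period]
  rw [← lintegral_iUnion (fun n => measurableSet_Ioc) (Set.pairwise_disjoint_Ioc_add_zsmul _ _),
    iUnion_Ioc_add_zsmul (by positivity), setLIntegral_univ, lintegral_sub_left_eq_self f x]

/-- The Neumann heat kernel as a sum of extended nonnegative reals. -/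
noncomputable def neumannHeatKernelENN (L t x y : ℝ) : ENNReal :=
  ∑' n : ℤ, (ENNReal.ofReal (heatGauss t (x - y - 2 * (n : ℝ) * L)) +
    ENNReal.ofReal (heatGauss t (x + y - 2 * (n : ℝ) * L)))

lemma neumannHeatKernel_eq_toReal (L t x y : ℝ) :
    neumannHeatKernel L t x y = (neumannHeatKernelENN L t x y).toReal := by
  unfold neumannHeatKernel neumannHeatKernelENN
  rw [ENNReal.tsum_toReal_eq (fun n => by finiteness)]
  refine tsum_congr fun n => ?_
  rw [ENNReal.toReal_add (by finiteness) (by finiteness),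
    ENNReal.toReal_ofReal (heatGauss_nonneg _ _), ENNReal.toReal_ofReal (heatGauss_nonneg _ _)]

lemma neumannHeatKernel_nonneg (L t x y : ℝ) : 0 ≤ neumannHeatKernel L t x y := by
  rw [neumannHeatKernel_eq_toReal]; exact ENNReal.toReal_nonneg

lemma measurable_neumannHeatKernel (L : ℝ) :
    Measurable fun q : (ℝ × ℝ) × ℝ => neumannHeatKernel L q.1.1 q.1.2 q.2 := by
  simp_rw [neumannHeatKernel_eq_toReal]
  refine ENNReal.measurable_toReal.comp (Measurable.tsum fun n => ?_)
  exact (measurable_heatGauss.comp (g := fun q : ℝ × ℝ => heatGauss q.1 q.2)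
      (f := fun q : (ℝ × ℝ) × ℝ => (q.1.1, q.1.2 - q.2 - 2 * (n : ℝ) * L))
      (by fun_prop)).ennreal_ofReal.add
    (measurable_heatGauss.comp (g := fun q : ℝ × ℝ => heatGauss q.1 q.2)
      (f := fun q : (ℝ × ℝ) × ℝ => (q.1.1, q.1.2 + q.2 - 2 * (n : ℝ) * L))
      (by fun_prop)).ennreal_ofReal

lemma sq_mul_sq_sub_one_le {L w : ℝ} (n : ℤ) (hw : w ∈ Set.Icc (-L) (2 * L)) :
    L ^ 2 * ((n : ℝ) ^ 2 - 1) ≤ (w - 2 * (n : ℝ) * L) ^ 2 := by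
  obtain ⟨h1, h2⟩ := hw
  have hL : 0 ≤ L := by linarith
  rcases le_or_gt n 0 with hn | hn
  · have hn' : (n : ℝ) ≤ 0 := by exact_mod_cast hn
    rcases eq_or_lt_of_le hn with rfl | hn1
    · simp; nlinarith [sq_nonneg w, sq_nonneg L]
    · have hn1' : (n : ℝ) ≤ -1 := by exact_mod_cast (by lia : n ≤ -1)
      have : -(n : ℝ) * L ≤ w - 2 * n * L := by nlinarith
      have h0 : 0 ≤ -(n : ℝ) * L := by nlinarith
      nlinarith [sq_nonneg L]
  · rcases eq_or_lt_of_le (show 1 ≤ n from hn) with rfl | hn1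
    · simp; positivity
    · have hn1' : (2 : ℝ) ≤ n := by exact_mod_cast hn1
      have : (n : ℝ) * L ≤ 2 * n * L - w := by nlinarith
      have h0 : 0 ≤ (n : ℝ) * L := by nlinarith
      nlinarith [sq_nonneg L]

lemma summable_exp_neg_mul_sq_sub_one {c : ℝ} (hc : 0 < c) :
    Summable fun n : ℤ => exp (-(c * ((n : ℝ) ^ 2 - 1))) := by
  have h := (summable_pow_mul_jacobiTheta₂_term_bound 0 (T := c / π) (by positivity) 0).mul_left
    (exp c)
  refine h.congr fun n => ?_
  rw [pow_zero, one_mul, ← exp_add]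
  congr 1
  field_simp
  ring

lemma exists_neumannHeatKernelENN_le {L τ : ℝ} (hL : 0 < L) (hτ : 0 < τ) :
    ∃ C : ℝ, 0 ≤ C ∧ ∀ s ∈ Set.Ioc 0 τ, ∀ x ∈ Set.Icc 0 L, ∀ y ∈ Set.Icc 0 L,
      neumannHeatKernelENN L s x y ≤ ENNReal.ofReal (C / √s) := by
  set b : ℤ → ℝ := fun n => exp (-(L ^ 2 / (4 * τ) * ((n : ℝ) ^ 2 - 1))) / √(4 * π) with hb
  have hbn (n : ℤ) : 0 ≤ b n := by positivity
  have hbs : Summable b := (summable_exp_neg_mul_sq_sub_one (by positivity)).div_const _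
  have term {s w : ℝ} (hs : s ∈ Set.Ioc 0 τ) (hw : w ∈ Set.Icc (-L) (2 * L)) (n : ℤ) :
      heatGauss s (w - 2 * (n : ℝ) * L) ≤ b n / √s := by
    obtain ⟨hs0, hsτ⟩ := hs
    rw [heatGauss, sqrt_mul (by positivity), hb, div_div]
    gcongr
    have h := sq_mul_sq_sub_one_le n hw
    calc -(w - 2 * (n : ℝ) * L) ^ 2 / (4 * s)
        = -((w - 2 * (n : ℝ) * L) ^ 2 / (4 * s)) := by ring
      _ ≤ -((w - 2 * (n : ℝ) * L) ^ 2 / (4 * τ)) := by gcongr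
      _ ≤ -(L ^ 2 * ((n : ℝ) ^ 2 - 1) / (4 * τ)) := by gcongr
      _ = _ := by ring
  refine ⟨2 * ∑' n, b n, mul_nonneg zero_le_two (tsum_nonneg hbn), fun s hs x hx y hy => ?_⟩
  rw [← tsum_mul_left, ← tsum_div_const, ENNReal.ofReal_tsum_of_nonneg
    (fun n => by have := hbn n; positivity) ((hbs.mul_left 2).div_const _)]
  refine ENNReal.tsum_le_tsum fun n => ?_
  rw [← ENNReal.ofReal_add (heatGauss_nonneg _ _) (heatGauss_nonneg _ _)]
  refine ENNReal.ofReal_le_ofReal ?_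
  have h1 := term hs (w := x - y) ⟨by linarith [hx.1, hy.2], by linarith [hx.2, hy.1]⟩ n
  have h2 := term hs (w := x + y) ⟨by linarith [hx.1, hy.1], by linarith [hx.2, hy.2]⟩ n
  linarith [show 2 * b n / √s = b n / √s + b n / √s by ring]

lemma measurable_heatGauss_right (s : ℝ) : Measurable (heatGauss s) :=
  measurable_heatGauss.comp (measurable_const.prodMk measurable_id)

lemma lintegral_neumannHeatKernelENN {L s : ℝ} (hL : 0 < L) (hs : 0 < s) (x : ℝ) :
    ∫⁻ y in Set.Ioc 0 L, neumannHeatKernelENN L s x y = 1 := by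
  rw [← lintegral_heatGauss hs]
  exact lintegral_tsum_images hL (measurable_heatGauss_right s).ennreal_ofReal x

lemma ENNReal.tsum_sq_add_sq_le {ι : Type*} (a b : ι → ENNReal) :
    ∑' i, (a i ^ 2 + b i ^ 2) ≤ (∑' i, (a i + b i)) ^ 2 := by
  rw [sq, ← ENNReal.tsum_mul_right]
  refine ENNReal.tsum_le_tsum fun i => ?_
  calc a i ^ 2 + b i ^ 2 = a i * a i + b i * b i := by ring
    _ ≤ a i * (a i + b i) + b i * (a i + b i) := by
      gcongr
      · exact le_self_add
      · exact le_add_self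
    _ = (a i + b i) * (a i + b i) := by ring
    _ ≤ _ := by gcongr; exact ENNReal.le_tsum i

lemma le_lintegral_neumannHeatKernelENN_sq {L s : ℝ} (hL : 0 < L) (hs : 0 < s) (x : ℝ) :
    ENNReal.ofReal (1 / √(8 * π * s))
      ≤ ∫⁻ y in Set.Ioc 0 L, neumannHeatKernelENN L s x y ^ 2 := by
  rw [← lintegral_heatGauss_sq hs, ← lintegral_tsum_images hL
    ((measurable_heatGauss_right s).ennreal_ofReal.pow_const 2) x]
  exact lintegral_mono fun y => ENNReal.tsum_sq_add_sq_le _ _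

lemma integral_neumannHeatKernel_sq_bounds {L s C x : ℝ} (hL : 0 < L) (hs : 0 < s) (hC : 0 ≤ C)
    (hbound : ∀ y ∈ Set.Icc 0 L, neumannHeatKernelENN L s x y ≤ ENNReal.ofReal C) :
    1 / √(8 * π * s) ≤ ∫ y in (0 : ℝ)..L, neumannHeatKernel L s x y ^ 2 ∧
      ∫ y in (0 : ℝ)..L, neumannHeatKernel L s x y ^ 2 ≤ C := by
  have hmeas : Measurable fun y => neumannHeatKernel L s x y :=
    (measurable_neumannHeatKernel L).comp
      (g := fun q : (ℝ × ℝ) × ℝ => neumannHeatKernel L q.1.1 q.1.2 q.2)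
      (f := fun y => ((s, x), y)) (by fun_prop)
  have hsq (y) (hy : y ∈ Set.Ioc 0 L) : ENNReal.ofReal (neumannHeatKernel L s x y ^ 2)
      = neumannHeatKernelENN L s x y ^ 2 := by
    rw [ENNReal.ofReal_pow (neumannHeatKernel_nonneg ..), neumannHeatKernel_eq_toReal,
      ENNReal.ofReal_toReal
        ((hbound y (Set.Ioc_subset_Icc_self hy)).trans_lt ENNReal.ofReal_lt_top).ne]
  have hupper : ∫⁻ y in Set.Ioc 0 L, neumannHeatKernelENN L s x y ^ 2 ≤ ENNReal.ofReal C :=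
    calc ∫⁻ y in Set.Ioc 0 L, neumannHeatKernelENN L s x y ^ 2
        ≤ ∫⁻ y in Set.Ioc 0 L, ENNReal.ofReal C * neumannHeatKernelENN L s x y := by
          refine setLIntegral_mono' measurableSet_Ioc fun y hy => ?_
          rw [sq]
          gcongr
          exact hbound y (Set.Ioc_subset_Icc_self hy)
      _ = ENNReal.ofReal C := by
          rw [lintegral_const_mul' _ _ ENNReal.ofReal_ne_top,
            lintegral_neumannHeatKernelENN hL hs, mul_one]
  have hint : ∫ y in (0 : ℝ)..L, neumannHeatKernel L s x y ^ 2
      = (∫⁻ y in Set.Ioc 0 L, neumannHeatKernelENN L s x y ^ 2).toReal := by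
    rw [intervalIntegral.integral_of_le hL.le, integral_eq_lintegral_of_nonneg_ae
      (.of_forall fun y => sq_nonneg _) (hmeas.pow_const 2).aestronglyMeasurable,
      setLIntegral_congr_fun measurableSet_Ioc hsq]
  rw [hint]
  exact ⟨(ENNReal.ofReal_le_iff_le_toReal (hupper.trans_lt ENNReal.ofReal_lt_top).ne).1
      (le_lintegral_neumannHeatKernelENN_sq hL hs x),
    ENNReal.toReal_le_of_le_ofReal hC hupper⟩

lemma stronglyMeasurable_integral_neumannHeatKernel_sq {L : ℝ} (hL : 0 < L) :
    StronglyMeasurable fun q : ℝ × ℝ => ∫ y in (0 : ℝ)..L, neumannHeatKernel L q.1 q.2 y ^ 2 := by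
  simp_rw [intervalIntegral.integral_of_le hL.le]
  exact ((measurable_neumannHeatKernel L).pow_const 2).stronglyMeasurable.integral_prod_right

lemma stronglyMeasurable_integral_integral_neumannHeatKernel_sq {L : ℝ} (hL : 0 < L) :
    StronglyMeasurable fun s : ℝ =>
      ∫ x in (0 : ℝ)..L, ∫ y in (0 : ℝ)..L, neumannHeatKernel L s x y ^ 2 := by
  simp_rw [intervalIntegral.integral_of_le hL.le (f := fun x => ∫ y in (0 : ℝ)..L, _)]
  exact (stronglyMeasurable_integral_neumannHeatKernel_sq hL).integral_prod_right

lemma integral_integral_neumannHeatKernel_sq_bounds {L s C : ℝ} (hL : 0 < L) (hs : 0 < s)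
    (hC : 0 ≤ C) (hbound : ∀ x ∈ Set.Icc 0 L, ∀ y ∈ Set.Icc 0 L,
      neumannHeatKernelENN L s x y ≤ ENNReal.ofReal C) :
    L * (1 / √(8 * π * s))
        ≤ ∫ x in (0 : ℝ)..L, ∫ y in (0 : ℝ)..L, neumannHeatKernel L s x y ^ 2 ∧
      ∫ x in (0 : ℝ)..L, ∫ y in (0 : ℝ)..L, neumannHeatKernel L s x y ^ 2 ≤ L * C := by
  have hb (x) (hx : x ∈ Set.Icc 0 L) :=
    integral_neumannHeatKernel_sq_bounds hL hs hC (hbound x hx)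
  have hmeas : StronglyMeasurable fun x => ∫ y in (0 : ℝ)..L, neumannHeatKernel L s x y ^ 2 :=
    (stronglyMeasurable_integral_neumannHeatKernel_sq hL).comp_measurable
      (f := fun q : ℝ × ℝ => ∫ y in (0 : ℝ)..L, neumannHeatKernel L q.1 q.2 y ^ 2)
      (g := fun x => (s, x)) (by fun_prop)
  have hint : IntervalIntegrable (fun x => ∫ y in (0 : ℝ)..L, neumannHeatKernel L s x y ^ 2)
      volume 0 L := by
    refine (intervalIntegrable_const (c := C)).mono_fun hmeas.aestronglyMeasurable ?_
    refine (ae_restrict_iff' measurableSet_uIoc).2 (.of_forall fun x hx => ?_)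
    rw [Set.uIoc_of_le hL.le] at hx
    have h := hb x (Set.Ioc_subset_Icc_self hx)
    dsimp only
    rw [norm_of_nonneg (le_trans (by positivity) h.1), norm_of_nonneg hC]
    exact h.2
  constructor
  · have h := intervalIntegral.integral_mono_on hL.le intervalIntegrable_const hint
      fun x hx => (hb x hx).1
    simpa using h
  · have h := intervalIntegral.integral_mono_on hL.le hint intervalIntegrable_const
      fun x hx => (hb x hx).2
    simpa using h

lemma inv_sqrt_eq_rpow {s : ℝ} (hs : 0 ≤ s) : 1 / √s = s ^ (-(1 / 2) : ℝ) := by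
  rw [rpow_neg hs, sqrt_eq_rpow, one_div]

lemma integral_inv_sqrt_eight_pi_mul {τ : ℝ} (hτ : 0 < τ) :
    ∫ s in (0 : ℝ)..τ, 1 / √(8 * π) * s ^ (-(1 / 2) : ℝ) = √(τ / (2 * π)) := by
  rw [intervalIntegral.integral_const_mul, integral_rpow (.inl (by norm_num)),
    zero_rpow (by norm_num), show (-(1 / 2) + 1 : ℝ) = 1 / 2 by norm_num, ← sqrt_eq_rpow,
    show 8 * π = 2 ^ 2 * (2 * π) by ring, sqrt_mul (by positivity), sqrt_sq (by norm_num),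
    sqrt_div hτ.le]
  field_simp
  ring

theorem neumann_Phi_lower_bound
    (L : ℝ) (hL : 0 < L) (τ : ℝ) (hτ : 0 < τ) :
    L * Real.sqrt (τ / (2 * π))
      ≤ ∫ s in (0 : ℝ)..τ, ∫ x in (0 : ℝ)..L, ∫ y in (0 : ℝ)..L,
          (neumannHeatKernel L s x y) ^ 2 := by
  obtain ⟨C, hC, hbound⟩ := exists_neumannHeatKernelENN_le hL hτ
  have hb (s) (hs : s ∈ Set.Ioc 0 τ) := integral_integral_neumannHeatKernel_sq_bounds hL hs.1
    (div_nonneg hC (sqrt_nonneg s)) (hbound s hs)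
  have hpow : IntervalIntegrable (fun s : ℝ => s ^ (-(1 / 2) : ℝ)) volume 0 τ :=
    intervalIntegral.intervalIntegrable_rpow' (by norm_num)
  have hint : IntervalIntegrable (fun s : ℝ => ∫ x in (0 : ℝ)..L, ∫ y in (0 : ℝ)..L,
      neumannHeatKernel L s x y ^ 2) volume 0 τ := by
    refine (hpow.const_mul (L * C)).mono_fun
      (stronglyMeasurable_integral_integral_neumannHeatKernel_sq hL).aestronglyMeasurable ?_
    refine (ae_restrict_iff' measurableSet_uIoc).2 (.of_forall fun s hs => ?_)
    rw [Set.uIoc_of_le hτ.le] at hs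
    have h := hb s hs
    dsimp only
    rw [← inv_sqrt_eq_rpow hs.1.le, norm_of_nonneg (le_trans (by positivity) h.1),
      norm_of_nonneg (by positivity)]
    exact h.2.trans_eq (by ring)
  rw [← integral_inv_sqrt_eight_pi_mul hτ, ← intervalIntegral.integral_const_mul]
  refine intervalIntegral.integral_mono_on_of_le_Ioo hτ.le
    ((hpow.const_mul _).const_mul _) hint fun s hs => ?_
  refine le_trans (le_of_eq ?_) (hb s (Set.Ioo_subset_Ioc_self hs)).1
  rw [← inv_sqrt_eq_rpow hs.1.le, sqrt_mul (by positivity : 0 ≤ 8 * π) s, one_div_mul_one_div]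
end

section
/- For every real x > 0, one has ∑_{k=1}^∞ (x/√k)ᵏ ≥ e^{x²/(2e)} − 1, where the sum on the left converges. -/
open Real

theorem pow_self_le_exp_mul_factorial (n : ℕ) :
    (n : ℝ) ^ n ≤ Real.exp 1 ^ n * (n.factorial : ℝ) := by
  have h := Real.pow_div_factorial_le_exp _ (Nat.cast_nonneg (α := ℝ) n) n
  rwa [div_le_iff₀ (by positivity), ← Real.exp_one_pow] at h

theorem summable_pow_div_sqrt (x : ℝ) (hx : 0 ≤ x) :
    Summable (fun k : ℕ => (x / Real.sqrt ((k : ℝ) + 1)) ^ (k + 1)) := by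
  have hsqrt : Filter.Tendsto (fun k : ℕ => Real.sqrt ((k : ℝ) + 1)) Filter.atTop Filter.atTop :=
    Real.tendsto_sqrt_atTop.comp
      (Filter.tendsto_atTop_add_const_right _ _ tendsto_natCast_atTop_atTop)
  have hlim := hsqrt.const_div_atTop x
  refine ((summable_nat_add_iff 1).2 summable_geometric_two).of_norm_bounded_eventually_nat ?_
  filter_upwards [hlim.eventually_le_const (show (0 : ℝ) < 1 / 2 by norm_num)] with k hk
  rw [Real.norm_of_nonneg (by positivity)]
  gcongr

theorem pow_div_factorial_le_pow_div_sqrt (x : ℝ) {n : ℕ} (hn : 0 < n) :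
    (x ^ 2 / (2 * Real.exp 1)) ^ n / (n.factorial : ℝ)
      ≤ (x / Real.sqrt (2 * (n : ℝ))) ^ (2 * n) := by
  have hn' : (0 : ℝ) < n := by exact_mod_cast hn
  calc (x ^ 2 / (2 * Real.exp 1)) ^ n / (n.factorial : ℝ)
      = (x ^ 2 / 2) ^ n / (Real.exp 1 ^ n * (n.factorial : ℝ)) := by
        rw [← div_div (x ^ 2), div_pow _ (Real.exp 1), div_div]
    _ ≤ (x ^ 2 / 2) ^ n / (n : ℝ) ^ n := by
        gcongr
        exact pow_self_le_exp_mul_factorial n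
    _ = (x / Real.sqrt (2 * (n : ℝ))) ^ (2 * n) := by
        rw [pow_mul, div_pow x, Real.sq_sqrt (by positivity), ← div_pow, div_div]

theorem sum_pow_div_sqrt_lower_bound (x : ℝ) (hx : 0 < x) :
    Summable (fun k : ℕ => (x / Real.sqrt ((k : ℝ) + 1)) ^ (k + 1)) ∧
      Real.exp (x ^ 2 / (2 * Real.exp 1)) - 1
        ≤ ∑' k : ℕ, (x / Real.sqrt ((k : ℝ) + 1)) ^ (k + 1) := by
  have hsum := summable_pow_div_sqrt x hx.le
  refine ⟨hsum, ?_⟩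
  have hexp : HasSum
      (fun j : ℕ => (x ^ 2 / (2 * Real.exp 1)) ^ (j + 1) / ((j + 1).factorial : ℝ))
      (Real.exp (x ^ 2 / (2 * Real.exp 1)) - 1) := by
    have h := NormedSpace.expSeries_div_hasSum_exp (x ^ 2 / (2 * Real.exp 1))
    rw [← Real.exp_eq_exp_ℝ] at h
    simpa using (hasSum_nat_add_iff' 1).2 h
  refine hasSum_le_inj (fun j : ℕ => 2 * j + 1) (fun a b h => by simpa using h)
    (fun k _ => by positivity) (fun j => ?_) hexp hsum.hasSum
  have hcast : ((2 * j + 1 : ℕ) : ℝ) + 1 = 2 * ((j + 1 : ℕ) : ℝ) := by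
    push_cast
    ring
  rw [hcast]
  exact pow_div_factorial_le_pow_div_sqrt x j.succ_pos
end

section
/- Let f : (0,∞) → [0,∞) be measurable and locally integrable, let c ≥ 0 and λ, ℓ > 0, and suppose that f(t) ≥ c H(t) + (λ²ℓ²/2) ∫₀ᵗ (t − s) f(s) ds for all t > 0. Then for every t > 0, f(t) ≥ c H(t) · ∑_{n=1}^∞ (λ ℓ t/(2√8))^{2n} / (2n)!. -/
open MeasureTheory Real

/-- `H(r) = min(r/2, r²/4)`. -/
noncomputable def Hfun (r : ℝ) : ℝ := min (r / 2) (r ^ 2 / 4)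

lemma Hfun_div_four_le {s t : ℝ} (ht : 0 ≤ t) (hs : t / 2 ≤ s) : Hfun t / 4 ≤ Hfun s := by
  unfold Hfun
  refine le_min ?_ ?_
  · have := min_le_left (t / 2) (t ^ 2 / 4)
    linarith
  · have := min_le_right (t / 2) (t ^ 2 / 4)
    nlinarith

lemma Hfun_nonneg {t : ℝ} (ht : 0 ≤ t) : 0 ≤ Hfun t :=
  le_min (by positivity) (by positivity)

lemma integral_sub_mul_pow (b t : ℝ) (m : ℕ) :
    ∫ s in b..t, (t - s) * (s - b) ^ m = (t - b) ^ (m + 2) / ((m + 1) * (m + 2)) := by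
  have hm : (m : ℝ) + 1 ≠ 0 := by positivity
  have hm' : (m : ℝ) + 2 ≠ 0 := by positivity
  have hderiv : ∀ s ∈ Set.uIcc b t, HasDerivAt
      (fun s : ℝ => (t - s) * (s - b) ^ (m + 1) / (m + 1)
        + (s - b) ^ (m + 2) / ((m + 1) * (m + 2))) ((t - s) * (s - b) ^ m) s := by
    intro s _
    have hsub : HasDerivAt (fun s : ℝ => s - b) 1 s := (hasDerivAt_id s).sub_const b
    have hsub' : HasDerivAt (fun s : ℝ => t - s) (-1) s := (hasDerivAt_id s).const_sub t
    refine HasDerivAt.congr_deriv (((hsub'.mul (hsub.pow (m + 1))).div_const ((m : ℝ) + 1)).add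
      ((hsub.pow (m + 2)).div_const (((m : ℝ) + 1) * (m + 2)))) ?_
    simp only [Nat.add_sub_cancel, show m + 2 - 1 = m + 1 from rfl, Pi.pow_apply]
    push_cast
    field_simp
    ring
  rw [intervalIntegral.integral_eq_sub_of_hasDerivAt hderiv
    (by apply Continuous.intervalIntegrable; fun_prop)]
  simp

/-- Integrating the partial sums of `cosh` twice shifts them by one term. -/
lemma integral_sub_mul_cosh_partial_sum (k b t : ℝ) (N : ℕ) :
    k ^ 2 * ∫ s in b..t, (t - s) * ∑ n ∈ Finset.range N, (k * (s - b)) ^ (2 * n) / (2 * n).factorial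
      = ∑ n ∈ Finset.range N, (k * (t - b)) ^ (2 * (n + 1)) / (2 * (n + 1)).factorial := by
  simp_rw [Finset.mul_sum]
  rw [intervalIntegral.integral_finsetSum
    (fun n _ => by apply Continuous.intervalIntegrable; fun_prop), Finset.mul_sum]
  refine Finset.sum_congr rfl fun n _ => ?_
  have hrw : ∀ s : ℝ, (t - s) * ((k * (s - b)) ^ (2 * n) / (2 * n).factorial)
      = k ^ (2 * n) / (2 * n).factorial * ((t - s) * (s - b) ^ (2 * n)) := by
    intro s
    rw [mul_pow]
    ring
  simp_rw [hrw]
  rw [intervalIntegral.integral_const_mul, integral_sub_mul_pow,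
    show 2 * (n + 1) = 2 * n + 1 + 1 by ring, Nat.factorial_succ, Nat.factorial_succ]
  rw [show 2 * n + 1 + 1 = 2 * n + 2 from rfl, mul_pow k (t - b)]
  have hfac : ((2 * n).factorial : ℝ) ≠ 0 := by positivity
  push_cast
  field_simp
  ring

/-- A nonnegative supersolution of `f(t) = d + k² ∫_b^t (t - s) f(s) ds` on `[b, T]`
dominates `d cosh (k (t - b))`. -/
lemma mul_cosh_le_of_renewal {f : ℝ → ℝ} {b T d k : ℝ}
    (hf_nonneg : ∀ t ∈ Set.Icc b T, 0 ≤ f t) (hf_int : IntervalIntegrable f volume b T)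
    (hrec : ∀ t ∈ Set.Icc b T, d + k ^ 2 * ∫ s in b..t, (t - s) * f s ≤ f t)
    {t : ℝ} (ht : t ∈ Set.Icc b T) : d * cosh (k * (t - b)) ≤ f t := by
  have key : ∀ N : ℕ, ∀ t ∈ Set.Icc b T,
      d * ∑ n ∈ Finset.range N, (k * (t - b)) ^ (2 * n) / (2 * n).factorial ≤ f t := by
    intro N
    induction N with
    | zero => simpa using hf_nonneg
    | succ N ih =>
      intro t ht
      refine le_trans ?_ (hrec t ht)
      rw [Finset.sum_range_succ', ← integral_sub_mul_cosh_partial_sum]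
      have hmono : d * ∫ s in b..t, (t - s) *
          ∑ n ∈ Finset.range N, (k * (s - b)) ^ (2 * n) / (2 * n).factorial
          ≤ ∫ s in b..t, (t - s) * f s := by
        rw [← intervalIntegral.integral_const_mul]
        refine intervalIntegral.integral_mono_on ht.1
          (by apply Continuous.intervalIntegrable; fun_prop) ?_ fun s hs => ?_
        · refine IntervalIntegrable.continuousOn_mul (hf_int.mono_set ?_) (by fun_prop)
          exact Set.uIcc_subset_uIcc_left (Set.Icc_subset_uIcc ht)
        · have := mul_le_mul_of_nonneg_left (ih s ⟨hs.1, hs.2.trans ht.2⟩) (sub_nonneg.2 hs.2)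
          linarith
      have := mul_le_mul_of_nonneg_left hmono (sq_nonneg k)
      simp only [mul_zero, pow_zero, Nat.factorial_zero, Nat.cast_one, div_one]
      linarith
  exact le_of_tendsto' ((hasSum_cosh (k * (t - b))).tendsto_sum_nat.const_mul d)
    fun N => key N t ht

lemma tsum_pow_div_factorial_eq_cosh_sub_one (y : ℝ) :
    ∑' n : ℕ, y ^ (2 * (n + 1)) / (2 * (n + 1)).factorial = cosh y - 1 := by
  have h := (hasSum_cosh y).summable.tsum_eq_zero_add
  rw [(hasSum_cosh y).tsum_eq] at h
  simp only [mul_zero, pow_zero, Nat.factorial_zero, Nat.cast_one, div_one] at h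
  linarith

theorem wave_renewal_lower_bound
    (f : ℝ → ℝ) (hf_meas : Measurable f) (hf_nonneg : ∀ t, 0 < t → 0 ≤ f t)
    (hf_int : ∀ t, 0 < t → IntervalIntegrable f volume 0 t)
    (c lam ell : ℝ) (hc : 0 ≤ c) (hlam : 0 < lam) (hell : 0 < ell)
    (hrec : ∀ t, 0 < t →
      c * Hfun t + lam ^ 2 * ell ^ 2 / 2 * ∫ s in (0 : ℝ)..t, (t - s) * f s ≤ f t) :
    ∀ t, 0 < t →
      c * Hfun t *
          ∑' n : ℕ, (lam * ell * t / (2 * Real.sqrt 8)) ^ (2 * (n + 1)) /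
            (2 * (n + 1)).factorial
        ≤ f t := by
  intro T hT
  rw [tsum_pow_div_factorial_eq_cosh_sub_one]
  have hT2 : 0 < T / 2 := by positivity
  have hcH : 0 ≤ c * Hfun T := mul_nonneg hc (Hfun_nonneg hT.le)
  have hk : (4 * (lam * ell / (2 * √8))) ^ 2 = lam ^ 2 * ell ^ 2 / 2 := by
    have h8 : √8 ^ 2 = 8 := sq_sqrt (by norm_num)
    rw [mul_pow, div_pow, mul_pow 2, h8]
    ring
  have hcosh := mul_cosh_le_of_renewal (f := f) (b := T / 2) (T := T) (d := c * Hfun T / 4)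
    (k := 4 * (lam * ell / (2 * √8)))
    (fun t ht => hf_nonneg t (hT2.trans_le ht.1)) ((hf_int _ hT2).symm.trans (hf_int T hT)) ?_
    (t := T) ⟨by linarith, le_rfl⟩
  · rw [show 4 * (lam * ell / (2 * √8)) * (T - T / 2) = 2 * (lam * ell * T / (2 * √8)) by ring,
      cosh_two_mul, sinh_sq] at hcosh
    refine le_trans ?_ hcosh
    nlinarith [mul_nonneg hcH (sq_nonneg (cosh (lam * ell * T / (2 * √8)) - 1))]
  · intro t ht
    have ht0 : 0 < t := hT2.trans_le ht.1
    refine le_trans ?_ (hrec t ht0)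
    rw [hk]
    have hH : c * Hfun T / 4 ≤ c * Hfun t := by
      rw [mul_div_assoc]
      exact mul_le_mul_of_nonneg_left (Hfun_div_four_le hT.le ht.1) hc
    have hint : ∀ u, 0 < u → IntervalIntegrable (fun s => (t - s) * f s) volume 0 u :=
      fun u hu => (hf_int u hu).continuousOn_mul (by fun_prop)
    have hsplit := intervalIntegral.integral_add_adjacent_intervals (hint _ hT2)
      ((hint _ hT2).symm.trans (hint t ht0))
    have hpos : 0 ≤ ∫ s in (0 : ℝ)..(T / 2), (t - s) * f s := by
      rw [intervalIntegral.integral_of_le hT2.le]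
      exact setIntegral_nonneg measurableSet_Ioc fun s hs =>
        mul_nonneg (sub_nonneg.2 (hs.2.trans ht.1)) (hf_nonneg s hs.1)
    exact add_le_add hH (mul_le_mul_of_nonneg_left (by linarith) (by positivity))
end

section
/- Let f : [0,∞) → [0,∞) be measurable, let C ≥ 0, b > 0 and δ ∈ (0,1), set β := √(b/(2(1−δ))) · √2 = √(b/(1−δ)), and suppose that f(t) ≤ C t² + (b/2) ∫₀ᵗ (t − s) f(s) ds for all t ≥ 0, and that ℱ(β) := sup_{t ≥ 0} e^{−βt} f(t) < ∞. Then ℱ(β) ≤ 4C/(δ e² β²); that is, f(t) ≤ (4C/(δ e² β²)) · e^{βt} for all t ≥ 0. -/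
open MeasureTheory Real

/-- The maximum of `t ^ 2 * exp (-β t)` on the half-line, attained at `t = 2 / β`. -/
lemma sq_le_mul_exp {β t : ℝ} (hβ : 0 < β) (ht : 0 ≤ t) :
    t ^ 2 ≤ 4 / (exp 1 ^ 2 * β ^ 2) * exp (β * t) := by
  have h : β * t / 2 * exp 1 ≤ exp (β * t / 2) := by
    have h' := add_one_le_exp (β * t / 2 - 1)
    rw [exp_sub, le_div_iff₀ (exp_pos 1)] at h'
    linarith
  have h_sq : (β * t / 2 * exp 1) ^ 2 ≤ exp (β * t) := by
    calc (β * t / 2 * exp 1) ^ 2 ≤ exp (β * t / 2) ^ 2 := by gcongr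
      _ = exp (β * t) := by rw [← exp_nat_mul]; congr 1; push_cast; ring
  rw [div_mul_eq_mul_div, le_div_iff₀ (by positivity)]
  linarith

lemma integral_sub_mul_exp {β : ℝ} (hβ : β ≠ 0) (t : ℝ) :
    ∫ s in (0 : ℝ)..t, (t - s) * exp (β * s) = (exp (β * t) - 1 - β * t) / β ^ 2 := by
  have hderiv : ∀ s ∈ Set.uIcc 0 t,
      HasDerivAt (fun s => (t - s) * (exp (β * s) / β) + exp (β * s) / β ^ 2)
        ((t - s) * exp (β * s)) s := by
    intro s _
    have hexp : HasDerivAt (fun s => exp (β * s)) (exp (β * s) * (β * 1)) s :=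
      ((hasDerivAt_id s).const_mul β).exp
    refine ((((hasDerivAt_id' s).const_sub t).mul (hexp.div_const β)).add
      (hexp.div_const (β ^ 2))).congr_deriv ?_
    field_simp
    ring
  rw [intervalIntegral.integral_eq_sub_of_hasDerivAt hderiv
    (Continuous.intervalIntegrable (by fun_prop) _ _)]
  simp only [sub_self, zero_mul, mul_zero, exp_zero]
  field_simp
  ring

/-- Measurability of `f` is not needed: the Bochner integral of a non-integrable function is `0`. -/
lemma integral_sub_mul_le {f : ℝ → ℝ} {β M t : ℝ} (hβ : 0 < β) (hM : 0 ≤ M) (ht : 0 ≤ t)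
    (hf_nonneg : ∀ s, 0 ≤ s → 0 ≤ f s) (hf : ∀ s, 0 ≤ s → f s ≤ M * exp (β * s)) :
    ∫ s in (0 : ℝ)..t, (t - s) * f s ≤ M * exp (β * t) / β ^ 2 := by
  calc ∫ s in (0 : ℝ)..t, (t - s) * f s
      ≤ ∫ s in (0 : ℝ)..t, M * ((t - s) * exp (β * s)) := by
        rw [intervalIntegral.integral_of_le ht, intervalIntegral.integral_of_le ht]
        refine integral_mono_of_nonneg ?_ ?_ ?_
        · filter_upwards [ae_restrict_mem measurableSet_Ioc] with s hs
          exact mul_nonneg (sub_nonneg.2 hs.2) (hf_nonneg s hs.1.le)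
        · exact (Continuous.intervalIntegrable (by fun_prop) 0 t).1
        · filter_upwards [ae_restrict_mem measurableSet_Ioc] with s hs
          have := mul_le_mul_of_nonneg_left (hf s hs.1.le) (sub_nonneg.2 hs.2)
          linarith
    _ = M * (exp (β * t) - 1 - β * t) / β ^ 2 := by
        rw [intervalIntegral.integral_const_mul, integral_sub_mul_exp hβ.ne', mul_div_assoc]
    _ ≤ M * exp (β * t) / β ^ 2 := by
        gcongr
        linarith [mul_nonneg hβ.le ht]

theorem wave_renewal_upper_bound
    (f : ℝ → ℝ) (hf_meas : Measurable f) (hf_nonneg : ∀ t, 0 ≤ t → 0 ≤ f t)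
    (C b δ β : ℝ) (hC : 0 ≤ C) (hb : 0 < b) (hδ : δ ∈ Set.Ioo (0 : ℝ) 1)
    (hβ : β = Real.sqrt (b / (1 - δ)))
    (hrec : ∀ t, 0 ≤ t →
      f t ≤ C * t ^ 2 + b / 2 * ∫ s in (0 : ℝ)..t, (t - s) * f s)
    (hfin : BddAbove ((fun t => Real.exp (-β * t) * f t) '' Set.Ici (0 : ℝ))) :
    sSup ((fun t => Real.exp (-β * t) * f t) '' Set.Ici (0 : ℝ))
        ≤ 4 * C / (δ * Real.exp 1 ^ 2 * β ^ 2) ∧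
      ∀ t, 0 ≤ t → f t ≤ 4 * C / (δ * Real.exp 1 ^ 2 * β ^ 2) * Real.exp (β * t) := by
  obtain ⟨hδ0, hδ1⟩ := hδ
  have h1δ : 0 < 1 - δ := sub_pos.2 hδ1
  have hβ_pos : 0 < β := hβ ▸ sqrt_pos.2 (div_pos hb h1δ)
  have hβ_sq : b / β ^ 2 = 1 - δ := by
    rw [hβ, sq_sqrt (div_pos hb h1δ).le]
    field_simp
  set M := sSup ((fun t => exp (-β * t) * f t) '' Set.Ici (0 : ℝ))
  have hexp_cancel : ∀ t, exp (β * t) * exp (-β * t) = 1 := fun t => by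
    rw [← exp_add]; simp
  have hM_bound : ∀ t, 0 ≤ t → f t ≤ M * exp (β * t) := by
    intro t ht
    have h : exp (-β * t) * f t ≤ M := le_csSup hfin ⟨t, ht, rfl⟩
    calc f t = exp (-β * t) * f t * exp (β * t) := by linear_combination (-f t) * hexp_cancel t
      _ ≤ M * exp (β * t) := by gcongr
  have hM_nonneg : 0 ≤ M := by
    apply Real.sSup_nonneg
    rintro _ ⟨t, ht, rfl⟩
    exact mul_nonneg (exp_pos _).le (hf_nonneg t ht)
  have hM_renewal : M ≤ 4 * C / (exp 1 ^ 2 * β ^ 2) + (1 - δ) / 2 * M := by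
    refine csSup_le (Set.nonempty_Ici.image _) ?_
    rintro _ ⟨t, ht, rfl⟩
    have hf_le : f t ≤ (4 * C / (exp 1 ^ 2 * β ^ 2) + (1 - δ) / 2 * M) * exp (β * t) := by
      calc f t ≤ C * t ^ 2 + b / 2 * ∫ s in (0 : ℝ)..t, (t - s) * f s := hrec t ht
        _ ≤ C * (4 / (exp 1 ^ 2 * β ^ 2) * exp (β * t))
            + b / 2 * (M * exp (β * t) / β ^ 2) := by
          gcongr
          · exact sq_le_mul_exp hβ_pos ht
          · exact integral_sub_mul_le hβ_pos hM_nonneg ht hf_nonneg hM_bound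
        _ = _ := by rw [← hβ_sq]; ring
    calc exp (-β * t) * f t
        ≤ exp (-β * t) *
            ((4 * C / (exp 1 ^ 2 * β ^ 2) + (1 - δ) / 2 * M) * exp (β * t)) := by gcongr
      _ = _ := by
        linear_combination (4 * C / (exp 1 ^ 2 * β ^ 2) + (1 - δ) / 2 * M) * hexp_cancel t
  have hM_le : M ≤ 4 * C / (δ * exp 1 ^ 2 * β ^ 2) := by
    have h_eq : 4 * C / (δ * exp 1 ^ 2 * β ^ 2) = 4 * C / (exp 1 ^ 2 * β ^ 2) / δ := by
      field_simp
    rw [h_eq, le_div_iff₀ hδ0]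
    nlinarith [mul_nonneg hM_nonneg h1δ.le]
  refine ⟨hM_le, fun t ht => (hM_bound t ht).trans ?_⟩
  gcongr
end
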